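/- Let F be L-Lipschitz on the support of μ. If C_C(μ) · L < 1, then C'_C(μ_F) ≤ C_C(μ) / (1 − C_C(μ) L). -/

import Mathlib

open MeasureTheory Real Set
open scoped ENNReal RealInnerProductSpace Pointwise Matrix

noncomputable section

/-- Euclidean space ℝ^n. -/
abbrev En (n : ℕ) := EuclideanSpace ℝ (Fin n)

/-- Test functions: smooth, bounded and Lipschitz. -/
def IsTestFun {n : ℕ} (f : En n → ℝ) : Prop :=
  ContDiff ℝ (⊤ : ℕ∞) f ∧ (∃ M, ∀ x, |f x| ≤ M) ∧ ∃ L, LipschitzWith L f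

/-- `μ` satisfies a Poincaré inequality with constant `C`. -/
def PoincareLE {n : ℕ} (μ : Measure (En n)) (C : ℝ) : Prop :=
  ∀ f : En n → ℝ, IsTestFun f →
    (∫ x, (f x) ^ 2 ∂μ) - (∫ x, f x ∂μ) ^ 2 ≤ C * ∫ x, ‖gradient f x‖ ^ 2 ∂μ

/-- `μ` satisfies a logarithmic Sobolev inequality with constant `C`. -/
def LogSobolevLE {n : ℕ} (μ : Measure (En n)) (C : ℝ) : Prop :=
  ∀ f : En n → ℝ, IsTestFun f →
    (∫ x, (f x) ^ 2 * Real.log ((f x) ^ 2) ∂μ)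
        - (∫ x, (f x) ^ 2 ∂μ) * Real.log (∫ x, (f x) ^ 2 ∂μ)
      ≤ C * ∫ x, ‖gradient f x‖ ^ 2 ∂μ

/-- `μ` satisfies an L¹-Poincaré inequality (around the mean) with constant `C`. -/
def CheegerMeanLE {n : ℕ} (μ : Measure (En n)) (C : ℝ) : Prop :=
  ∀ f : En n → ℝ, IsTestFun f →
    ∫ x, |f x - ∫ y, f y ∂μ| ∂μ ≤ C * ∫ x, ‖gradient f x‖ ∂μ

/-- `m` is a median of `f` under `μ`. -/
def IsMedian {n : ℕ} (μ : Measure (En n)) (f : En n → ℝ) (m : ℝ) : Prop :=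
  ENNReal.ofReal (1 / 2) ≤ μ {x | f x ≤ m} ∧ ENNReal.ofReal (1 / 2) ≤ μ {x | m ≤ f x}

/-- `μ` satisfies a Cheeger inequality (around medians) with constant `C`. -/
def CheegerMedianLE {n : ℕ} (μ : Measure (En n)) (C : ℝ) : Prop :=
  ∀ f : En n → ℝ, IsTestFun f → ∀ m : ℝ, IsMedian μ f m →
    ∫ x, |f x - m| ∂μ ≤ C * ∫ x, ‖gradient f x‖ ∂μ

/-- The perturbed (normalized) measure `μ_F = Z_F⁻¹ e^{-F} μ`. -/
def perturb {n : ℕ} (μ : Measure (En n)) (F : En n → ℝ) : Measure (En n) :=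
  (ENNReal.ofReal (∫ x, Real.exp (-F x) ∂μ))⁻¹ •
    μ.withDensity fun x => ENNReal.ofReal (Real.exp (-F x))

/-- Topological support of a measure. -/
def measSupport {n : ℕ} (μ : Measure (En n)) : Set (En n) :=
  {x | ∀ U ∈ nhds x, 0 < μ U}

/-- `μ` is log-concave: it has density `e^{-W}` on a convex set, with `W` convex
(equivalently, density `e^{-W}` with `W : ℝⁿ → ℝ ∪ {+∞}` convex). -/
def IsLogConcave {n : ℕ} (μ : Measure (En n)) : Prop :=
  ∃ (s : Set (En n)) (W : En n → ℝ), Convex ℝ s ∧ ConvexOn ℝ s W ∧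
    μ = volume.withDensity (s.indicator fun x => ENNReal.ofReal (Real.exp (-W x)))

/-- The Laplacian of `F`. -/
def laplacian {n : ℕ} (F : En n → ℝ) (x : En n) : ℝ :=
  ∑ i : Fin n,
    fderiv ℝ (fun y => fderiv ℝ F y (EuclideanSpace.single i (1 : ℝ))) x
      (EuclideanSpace.single i (1 : ℝ))

/-- The generator `A F = ΔF - ∇V·∇F` associated with `μ = e^{-V} dx`. -/
def genA {n : ℕ} (V F : En n → ℝ) (x : En n) : ℝ :=
  laplacian F x - ⟪gradient V x, gradient F x⟫

/-- The centered Gaussian measure on ℝ^n with covariance matrix `σ² Id`. -/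
def gaussMeasure (n : ℕ) (σ : ℝ) : Measure (En n) :=
  volume.withDensity fun x =>
    ENNReal.ofReal ((2 * π * σ ^ 2) ^ (-(n : ℝ) / 2) * Real.exp (-‖x‖ ^ 2 / (2 * σ ^ 2)))

/-- Convolution of two measures. -/
def mconv {n : ℕ} (μ ν : Measure (En n)) : Measure (En n) :=
  (μ.prod ν).map fun p => p.1 + p.2

/-- Concentration profile of `μ`. -/
def concProfile {n : ℕ} (μ : Measure (En n)) (r : ℝ) : ℝ :=
  sSup {t | ∃ A : Set (En n), MeasurableSet A ∧ (1 : ℝ) / 2 ≤ (μ A).toReal ∧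
    t = 1 - (μ (A + Metric.ball (0 : En n) r)).toReal}

/-- Generalized inverse of the concentration profile. -/
def concInv {n : ℕ} (μ : Measure (En n)) (s : ℝ) : ℝ :=
  sInf {r | 0 < r ∧ concProfile μ r ≤ s}

/-- The Hessian matrix of `V` at `x`. -/
def hessMat {n : ℕ} (V : En n → ℝ) (x : En n) : Matrix (Fin n) (Fin n) ℝ :=
  fun i j =>
    fderiv ℝ (fun y => fderiv ℝ V y (EuclideanSpace.single j (1 : ℝ))) x
      (EuclideanSpace.single i (1 : ℝ))

end


theorem norm_gradient_eq {n : ℕ} (f : En n → ℝ) (x : En n) :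
    ‖gradient f x‖ = ‖fderiv ℝ f x‖ := by
  rw [← toDual_gradient (𝕜 := ℝ), LinearIsometryEquiv.norm_map]

/-- A Lipschitz function is uniformly approximated by smooth functions with the same Lipschitz
constant. -/
theorem LipschitzWith.exists_contDiff_lipschitzWith_dist_le {E : Type*} [NormedAddCommGroup E]
    [NormedSpace ℝ E] [FiniteDimensional ℝ E] {K : NNReal} {F : E → ℝ}
    (hF : LipschitzWith K F) {ε : ℝ} (hε : 0 < ε) :
    ∃ G : E → ℝ, ContDiff ℝ (⊤ : ℕ∞) G ∧ LipschitzWith K G ∧ ∀ x, |G x - F x| ≤ K * ε := by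
  borelize E
  let ρ : ContDiffBump (0 : E) := ⟨ε / 2, ε, half_pos hε, half_lt_self hε⟩
  let ν : Measure E := Measure.addHaar
  have hcont (x : E) : Integrable (fun t => ρ.normed ν t * F (x - t)) ν :=
    (ρ.continuous_normed.mul (hF.continuous.comp (by fun_prop))).integrable_of_hasCompactSupport
      (ρ.hasCompactSupport_normed.mul_right)
  refine ⟨convolution (ρ.normed ν) F (ContinuousLinearMap.lsmul ℝ ℝ) ν, ?_, ?_, ?_⟩
  · exact ρ.hasCompactSupport_normed.contDiff_convolution_left _ ρ.contDiff_normed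
      hF.continuous.locallyIntegrable
  · refine LipschitzWith.of_dist_le_mul fun x y => ?_
    simp only [convolution_lsmul, smul_eq_mul]
    rw [Real.dist_eq, ← integral_sub (hcont x) (hcont y), ← Real.norm_eq_abs]
    refine (norm_integral_le_of_norm_le
      (ρ.integrable_normed.mul_const (K * dist x y))
      (Filter.Eventually.of_forall fun t => ?_)).trans ?_
    · rw [← mul_sub, norm_mul, Real.norm_of_nonneg (ρ.nonneg_normed t), ← dist_eq_norm]
      refine mul_le_mul_of_nonneg_left ?_ (ρ.nonneg_normed t)
      simpa using hF.dist_le_mul (x - t) (y - t)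
    · rw [integral_mul_const, ρ.integral_normed, one_mul]
  · intro x
    rw [← Real.dist_eq]
    refine ρ.dist_normed_convolution_le hF.continuous.aestronglyMeasurable fun y hy => ?_
    exact (hF.dist_le_mul y x).trans
      (mul_le_mul_of_nonneg_left (Metric.mem_ball.1 hy).le K.coe_nonneg)

/-- A median minimizes the mean absolute deviation. -/
theorem integral_abs_sub_median_le {n : ℕ} {ν : Measure (En n)} [IsProbabilityMeasure ν]
    {f : En n → ℝ} (hfm : Measurable f) (hf : Integrable f ν) {m : ℝ} (hm : IsMedian ν f m)
    (c : ℝ) : ∫ x, |f x - m| ∂ν ≤ ∫ x, |f x - c| ∂ν := by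
  have key (s : Set (En n)) (hs : MeasurableSet s) (hhalf : ENNReal.ofReal (1 / 2) ≤ ν s)
      (a : ℝ) (ha : 0 ≤ a)
      (h : ∀ x, a * (2 * s.indicator (fun _ => (1 : ℝ)) x - 1) ≤ |f x - c| - |f x - m|) :
      ∫ x, |f x - m| ∂ν ≤ ∫ x, |f x - c| ∂ν := by
    have hi : Integrable (s.indicator fun _ => (1 : ℝ)) ν :=
      (integrable_const 1).indicator hs
    have h1 (b : ℝ) : Integrable (fun x => |f x - b|) ν := (hf.sub (integrable_const b)).abs
    have hint := integral_mono (μ := ν)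
      (f := fun x => a * (2 * s.indicator (fun _ => (1 : ℝ)) x - 1))
      (g := fun x => |f x - c| - |f x - m|)
      (((hi.const_mul 2).sub (integrable_const 1)).const_mul a) ((h1 c).sub (h1 m)) h
    rw [integral_sub (h1 c) (h1 m), integral_const_mul,
      integral_sub (hi.const_mul 2) (integrable_const 1), integral_const_mul,
      integral_indicator_const _ hs] at hint
    have h2 : 1 / 2 ≤ ν.real s :=
      (ENNReal.ofReal_le_iff_le_toReal (measure_ne_top ν s)).1 hhalf
    simp only [smul_eq_mul, mul_one, integral_const, probReal_univ] at hint
    nlinarith [mul_nonneg ha (by linarith : 0 ≤ 2 * ν.real s - 1)]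
  rcases le_total m c with h | h
  · refine key _ (measurableSet_le hfm measurable_const) hm.1 (c - m) (by linarith) fun x => ?_
    by_cases hx : f x ≤ m
    · rw [Set.indicator_of_mem (by exact hx), abs_of_nonpos (by linarith),
        abs_of_nonpos (by linarith)]
      linarith
    · rw [Set.indicator_of_notMem (by exact hx)]
      have := abs_sub_abs_le_abs_sub (f x - m) (f x - c)
      rw [show f x - m - (f x - c) = c - m by ring, abs_of_nonneg (by linarith : 0 ≤ c - m)] at this
      linarith
  · refine key _ (measurableSet_le measurable_const hfm) hm.2 (m - c) (by linarith) fun x => ?_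
    by_cases hx : m ≤ f x
    · rw [Set.indicator_of_mem (by exact hx), abs_of_nonneg (by linarith),
        abs_of_nonneg (by linarith)]
      linarith
    · rw [Set.indicator_of_notMem (by exact hx)]
      have := abs_sub_abs_le_abs_sub (f x - m) (f x - c)
      rw [show f x - m - (f x - c) = -(m - c) by ring, abs_neg,
        abs_of_nonneg (by linarith : 0 ≤ m - c)] at this
      linarith

theorem integral_perturb {n : ℕ} {μ : Measure (En n)} {F : En n → ℝ} (hF : Measurable F)
    (g : En n → ℝ) :
    ∫ x, g x ∂(perturb μ F) =
      (∫ x, Real.exp (-F x) ∂μ)⁻¹ * ∫ x, Real.exp (-F x) * g x ∂μ := by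
  rw [perturb, integral_smul_measure, integral_withDensity_eq_integral_toReal_smul
    (by fun_prop) (by simp), ENNReal.toReal_inv, ENNReal.toReal_ofReal
    (integral_nonneg fun x => (Real.exp_pos _).le)]
  simp [ENNReal.toReal_ofReal (Real.exp_pos _).le]

theorem isProbabilityMeasure_perturb {n : ℕ} {μ : Measure (En n)} {F : En n → ℝ}
    (hFint : Integrable (fun x => Real.exp (-F x)) μ) (hFpos : 0 < ∫ x, Real.exp (-F x) ∂μ) :
    IsProbabilityMeasure (perturb μ F) := by
  constructor
  rw [perturb, Measure.smul_apply, withDensity_apply _ MeasurableSet.univ, Measure.restrict_univ,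
    ← ofReal_integral_eq_lintegral_ofReal hFint
      (Filter.Eventually.of_forall fun x => (Real.exp_pos _).le), smul_eq_mul]
  exact ENNReal.inv_mul_cancel (by simpa using hFpos) ENNReal.ofReal_ne_top

theorem IsTestFun.exists_norm_fderiv_le {n : ℕ} {f : En n → ℝ} (hf : IsTestFun f) :
    ∃ K : ℝ, ∀ x, ‖fderiv ℝ f x‖ ≤ K := by
  obtain ⟨K, hK⟩ := hf.2.2
  exact ⟨K, fun x => norm_fderiv_le_of_lipschitz ℝ hK⟩

theorem IsTestFun.continuous_norm_fderiv {n : ℕ} {f : En n → ℝ} (hf : IsTestFun f) :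
    Continuous fun x => ‖fderiv ℝ f x‖ :=
  (hf.1.continuous_fderiv (by simp)).norm

/-- The `L¹`-Poincaré inequality applied to `(f - c) e^{-G}`, for a smooth Lipschitz `G` bounded
below. -/
theorem CheegerMeanLE.integral_exp_mul_abs_sub_le {n : ℕ} {μ : Measure (En n)}
    [IsProbabilityMeasure μ] {C : ℝ} (hC0 : 0 ≤ C) (hC : CheegerMeanLE μ C) {G : En n → ℝ}
    (hG : ContDiff ℝ (⊤ : ℕ∞) G) {L : NNReal} (hGL : LipschitzWith L G) {b : ℝ}
    (hb : ∀ x, b ≤ G x) {f : En n → ℝ} (hf : IsTestFun f) (c : ℝ) :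
    ∫ x, Real.exp (-G x) * |f x - c| ∂μ ≤ |∫ x, Real.exp (-G x) * (f x - c) ∂μ| +
      C * (∫ x, Real.exp (-G x) * ‖fderiv ℝ f x‖ ∂μ +
        L * ∫ x, Real.exp (-G x) * |f x - c| ∂μ) := by
  obtain ⟨K, hK⟩ := hf.exists_norm_fderiv_le
  obtain ⟨M, hM⟩ := hf.2.1
  have hfc := hf.1.continuous
  have hGc := hG.continuous
  have hexp (x : En n) : Real.exp (-G x) ≤ Real.exp (-b) := Real.exp_le_exp.2 (by linarith [hb x])
  have hfcM (x : En n) : |f x - c| ≤ M + |c| := (abs_sub _ _).trans (by linarith [hM x])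
  let h : En n → ℝ := fun x => Real.exp (-G x) * (f x - c)
  have hsm : ContDiff ℝ (⊤ : ℕ∞) h := (hG.neg.exp).mul (hf.1.sub contDiff_const)
  have hgrad (x : En n) : ‖fderiv ℝ h x‖ ≤
      Real.exp (-G x) * ‖fderiv ℝ f x‖ + L * (Real.exp (-G x) * |f x - c|) := by
    have hfd : HasFDerivAt f (fderiv ℝ f x) x := (hf.1.differentiable (by simp) x).hasFDerivAt
    have hGd : HasFDerivAt G (fderiv ℝ G x) x := (hG.differentiable (by simp) x).hasFDerivAt
    have hhd : HasFDerivAt h (Real.exp (-G x) • fderiv ℝ f x +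
        (f x - c) • Real.exp (-G x) • -fderiv ℝ G x) x := hGd.neg.exp.mul (hfd.sub_const c)
    rw [hhd.fderiv]
    refine (norm_add_le _ _).trans (add_le_add ?_ ?_)
    · rw [norm_smul, Real.norm_of_nonneg (Real.exp_pos _).le]
    · rw [norm_smul, norm_smul, norm_neg, Real.norm_of_nonneg (Real.exp_pos _).le,
        Real.norm_eq_abs]
      have := mul_le_mul_of_nonneg_left (norm_fderiv_le_of_lipschitz ℝ hGL (x₀ := x))
        (mul_nonneg (Real.exp_pos (-G x)).le (abs_nonneg (f x - c)))
      linarith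
  have hbd1 (x : En n) : Real.exp (-G x) * ‖fderiv ℝ f x‖ ≤ Real.exp (-b) * K :=
    mul_le_mul (hexp x) (hK x) (norm_nonneg _) (Real.exp_pos _).le
  have hbd2 (x : En n) : Real.exp (-G x) * |f x - c| ≤ Real.exp (-b) * (M + |c|) :=
    mul_le_mul (hexp x) (hfcM x) (abs_nonneg _) (Real.exp_pos _).le
  have htest : IsTestFun h := by
    refine ⟨hsm, ⟨Real.exp (-b) * (M + |c|), fun x => ?_⟩, ⟨Real.toNNReal (Real.exp (-b) * K +
      L * (Real.exp (-b) * (M + |c|))), ?_⟩⟩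
    · rw [abs_mul, abs_of_pos (Real.exp_pos _)]
      exact hbd2 x
    · refine lipschitzWith_of_nnnorm_fderiv_le (𝕜 := ℝ) (hsm.differentiable (by simp)) fun x => ?_
      rw [← NNReal.coe_le_coe, coe_nnnorm]
      refine le_trans ?_ (Real.le_coe_toNNReal _)
      exact (hgrad x).trans (add_le_add (hbd1 x)
        (mul_le_mul_of_nonneg_left (hbd2 x) L.coe_nonneg))
  have hi1 : Integrable (fun x => Real.exp (-G x) * ‖fderiv ℝ f x‖) μ :=
    Integrable.of_bound ((Real.continuous_exp.comp hGc.neg).mul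
      hf.continuous_norm_fderiv).aestronglyMeasurable (Real.exp (-b) * K)
      (Filter.Eventually.of_forall fun x => by
        rw [Real.norm_of_nonneg (by positivity)]; exact hbd1 x)
  have hih : Integrable h μ :=
    Integrable.of_bound hsm.continuous.aestronglyMeasurable (Real.exp (-b) * (M + |c|))
      (Filter.Eventually.of_forall fun x => by
        rw [norm_mul, Real.norm_of_nonneg (Real.exp_pos _).le, Real.norm_eq_abs]; exact hbd2 x)
  have habs (x : En n) : |h x| = Real.exp (-G x) * |f x - c| := by
    rw [abs_mul, abs_of_pos (Real.exp_pos _)]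
  have hi2 : Integrable (fun x => Real.exp (-G x) * |f x - c|) μ := by
    simpa only [habs] using hih.abs
  have hpoin := hC h htest
  simp only [norm_gradient_eq] at hpoin
  have hi3 : Integrable (fun x => ‖fderiv ℝ h x‖) μ :=
    (hi1.add (hi2.const_mul L)).mono' htest.continuous_norm_fderiv.aestronglyMeasurable
      (Filter.Eventually.of_forall fun x => by simpa using hgrad x)
  have h1 : ∫ x, ‖fderiv ℝ h x‖ ∂μ ≤ ∫ x, Real.exp (-G x) * ‖fderiv ℝ f x‖ ∂μ +
      L * ∫ x, Real.exp (-G x) * |f x - c| ∂μ := by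
    rw [← integral_const_mul, ← integral_add hi1 (hi2.const_mul _)]
    exact integral_mono hi3 (hi1.add (hi2.const_mul _)) hgrad
  have hi4 : Integrable (fun x => |h x - ∫ y, h y ∂μ|) μ := (hih.sub (integrable_const _)).abs
  have h2 : ∫ x, |h x| ∂μ ≤ ∫ x, |h x - ∫ y, h y ∂μ| ∂μ + |∫ y, h y ∂μ| := by
    have := integral_mono (μ := μ) (f := fun x => |h x|)
      (g := fun x => |h x - ∫ y, h y ∂μ| + |∫ y, h y ∂μ|) hih.abs
      (hi4.add (integrable_const _))
      (fun x => by simpa using abs_add_le (h x - ∫ y, h y ∂μ) (∫ y, h y ∂μ))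
    rwa [integral_add hi4 (integrable_const _), integral_const,
      probReal_univ, one_smul] at this
  simp only [habs] at h2
  linarith [mul_le_mul_of_nonneg_left h1 hC0]

/-- The conclusion of `CheegerMeanLE.integral_exp_mul_abs_sub_le` for Lipschitz weights. -/
theorem CheegerMeanLE.integral_exp_mul_abs_sub_le_of_lipschitzWith {n : ℕ} {μ : Measure (En n)}
    [IsProbabilityMeasure μ] {C : ℝ} (hC0 : 0 ≤ C) (hC : CheegerMeanLE μ C) {F : En n → ℝ}
    {L : NNReal} (hFL : LipschitzWith L F) (hFint : Integrable (fun x => Real.exp (-F x)) μ)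
    {f : En n → ℝ} (hf : IsTestFun f) (c : ℝ) :
    ∫ x, Real.exp (-F x) * |f x - c| ∂μ ≤ |∫ x, Real.exp (-F x) * (f x - c) ∂μ| +
      C * (∫ x, Real.exp (-F x) * ‖fderiv ℝ f x‖ ∂μ +
        L * ∫ x, Real.exp (-F x) * |f x - c| ∂μ) := by
  obtain ⟨K, hK⟩ := hf.exists_norm_fderiv_le
  obtain ⟨M, hM⟩ := hf.2.1
  have hfc := hf.1.continuous
  have hfcM (x : En n) : |f x - c| ≤ M + |c| := (abs_sub _ _).trans (by linarith [hM x])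
  choose G hGs hGL hGd using fun k : ℕ =>
    (hFL.max_const (-(k : ℝ))).exists_contDiff_lipschitzWith_dist_le
      (Nat.one_div_pos_of_nat (α := ℝ) (n := k))
  have hLk (k : ℕ) : (L : ℝ) * (1 / ((k : ℝ) + 1)) ≤ L := by
    refine mul_le_of_le_one_right L.coe_nonneg ?_
    rw [div_le_one (by positivity)]
    linarith [Nat.cast_nonneg (α := ℝ) k]
  have hlim (x : En n) : Filter.Tendsto (fun k => G k x) Filter.atTop (nhds (F x)) := by
    have h1 : Filter.Tendsto (fun k : ℕ => (L : ℝ) * (1 / ((k : ℝ) + 1))) Filter.atTop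
        (nhds 0) := by
      simpa using (tendsto_one_div_add_atTop_nhds_zero_nat (𝕜 := ℝ)).const_mul (L : ℝ)
    refine tendsto_iff_dist_tendsto_zero.2
      (squeeze_zero' (Filter.Eventually.of_forall fun _ => dist_nonneg) ?_ h1)
    filter_upwards [Filter.eventually_ge_atTop ⌈-F x⌉₊] with k hk
    have := hGd k x
    rwa [max_eq_left (by linarith [Nat.ceil_le.1 hk])] at this
  have hexp (k : ℕ) (x : En n) : Real.exp (-G k x) ≤ Real.exp L * Real.exp (-F x) := by
    rw [← Real.exp_add]
    exact Real.exp_le_exp.2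
      (by linarith [(abs_le.1 (hGd k x)).1, le_max_left (F x) (-(k : ℝ)), hLk k])
  have hconv (g : En n → ℝ) (hg : Continuous g) (B : ℝ) (hB : ∀ x, |g x| ≤ B) :
      Filter.Tendsto (fun k => ∫ x, Real.exp (-G k x) * g x ∂μ) Filter.atTop
        (nhds (∫ x, Real.exp (-F x) * g x ∂μ)) := by
    refine tendsto_integral_of_dominated_convergence
      (fun x => Real.exp L * Real.exp (-F x) * B)
      (fun k => ((Real.continuous_exp.comp (hGs k).continuous.neg).mul hg).aestronglyMeasurable)
      ((hFint.const_mul _).mul_const _)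
      (fun k => Filter.Eventually.of_forall fun x => ?_)
      (Filter.Eventually.of_forall fun x =>
        ((Real.continuous_exp.tendsto _).comp (hlim x).neg).mul_const _)
    rw [norm_mul, Real.norm_of_nonneg (Real.exp_pos _).le, Real.norm_eq_abs]
    exact mul_le_mul (hexp k x) (hB x) (abs_nonneg _) (by positivity)
  have hc1 := hconv (fun x => |f x - c|) (by fun_prop) (M + |c|) (by simpa using hfcM)
  have hc2 := hconv (fun x => f x - c) (by fun_prop) (M + |c|) hfcM
  have hc3 := hconv (fun x => ‖fderiv ℝ f x‖) hf.continuous_norm_fderiv K (by simpa using hK)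
  refine le_of_tendsto_of_tendsto' hc1
    (hc2.abs.add ((hc3.add (hc1.const_mul (L : ℝ))).const_mul C)) fun k => ?_
  exact hC.integral_exp_mul_abs_sub_le hC0 (hGs k) (hGL k) (b := -(k : ℝ) - L)
    (fun x => by linarith [(abs_le.1 (hGd k x)).1, le_max_right (F x) (-(k : ℝ)), hLk k]) hf c

theorem CheegerMeanLE.cheegerMedianLE_perturb {n : ℕ} {μ : Measure (En n)}
    [IsProbabilityMeasure μ] {C : ℝ} (hC0 : 0 ≤ C) (hC : CheegerMeanLE μ C) {F : En n → ℝ}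
    {L : NNReal} (hFL : LipschitzWith L F) (hFint : Integrable (fun x => Real.exp (-F x)) μ)
    (hFpos : 0 < ∫ x, Real.exp (-F x) ∂μ) (hs : C * L < 1) :
    CheegerMedianLE (perturb μ F) (C / (1 - C * L)) := by
  intro f hf m hm
  have := isProbabilityMeasure_perturb hFint hFpos
  obtain ⟨M, hM⟩ := hf.2.1
  have hfc := hf.1.continuous
  have hint : Integrable f (perturb μ F) :=
    Integrable.of_bound hfc.aestronglyMeasurable M (Filter.Eventually.of_forall hM)
  set c := ∫ x, f x ∂(perturb μ F) with hc
  refine (integral_abs_sub_median_le hfc.measurable hint hm c).trans ?_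
  simp only [norm_gradient_eq]
  have hmean : ∫ x, Real.exp (-F x) * (f x - c) ∂μ = 0 := by
    have h := integral_perturb (μ := μ) hFL.continuous.measurable (fun x => f x - c)
    rw [integral_sub hint (integrable_const c), integral_const, probReal_univ, one_smul, ← hc,
      sub_self] at h
    exact (mul_eq_zero.1 h.symm).resolve_left (inv_ne_zero hFpos.ne')
  have hmain := hC.integral_exp_mul_abs_sub_le_of_lipschitzWith hC0 hFL hFint hf c
  rw [hmean, abs_zero, zero_add] at hmain
  rw [integral_perturb hFL.continuous.measurable, integral_perturb hFL.continuous.measurable,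
    mul_left_comm]
  refine mul_le_mul_of_nonneg_left ?_ (inv_nonneg.2 hFpos.le)
  rw [div_mul_eq_mul_div, le_div_iff₀ (by linarith)]
  linarith

theorem ae_mem_measSupport {n : ℕ} (μ : Measure (En n)) : ∀ᵐ x ∂μ, x ∈ measSupport μ := by
  refine measure_null_of_locally_null _ fun x hx => ?_
  have hx' : ¬∀ U ∈ nhds x, 0 < μ U := hx
  push Not at hx'
  obtain ⟨U, hU, h0⟩ := hx'
  exact ⟨U, mem_nhdsWithin_of_mem_nhds hU, le_antisymm h0 bot_le⟩

/-- If `F` is `L`-Lipschitz on the support of `μ` and `C_C(μ)·L < 1`,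
then `C'_C(μ_F) ≤ C_C(μ)/(1 - C_C(μ) L)`. -/
theorem cheeger_of_lipschitz_perturbation
    {n : ℕ} (μ : Measure (En n)) [IsProbabilityMeasure μ] (V : En n → ℝ)
    (hμ : μ = volume.withDensity fun x => ENNReal.ofReal (Real.exp (-V x)))
    (F : En n → ℝ) (L : ℝ) (hL : 0 ≤ L)
    (hFlip : LipschitzOnWith (Real.toNNReal L) F (measSupport μ))
    (hFint : Integrable (fun x => Real.exp (-F x)) μ)
    (hFpos : 0 < ∫ x, Real.exp (-F x) ∂μ)
    (Cc : ℝ) (hCc : 0 ≤ Cc) (hC : CheegerMeanLE μ Cc)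
    (hs : Cc * L < 1) :
    CheegerMedianLE (perturb μ F) (Cc / (1 - Cc * L)) := by
  obtain ⟨F', hF', heq⟩ := hFlip.extend_real
  have hae : (fun x => Real.exp (-F x)) =ᵐ[μ] fun x => Real.exp (-F' x) := by
    filter_upwards [ae_mem_measSupport μ] with x hx
    rw [heq hx]
  have hpert : perturb μ F = perturb μ F' := by
    rw [perturb, perturb, integral_congr_ae hae, withDensity_congr_ae]
    filter_upwards [hae] with x hx
    rw [hx]
  rw [hpert]
  rw [integral_congr_ae hae] at hFpos
  have := hC.cheegerMedianLE_perturb hCc hF' (hFint.congr hae) hFpos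
    (by rwa [Real.coe_toNNReal L hL])
  rwa [Real.coe_toNNReal L hL] at this
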